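/- arXiv:2506.09750 — 2 statements merged into one kernel-verified Lean document; each statement's English description precedes it below -/
import Mathlib

section
/- Let G be a finite simple graph of order n ≥ 3. If d_G(x) + d_G(y) ≥ n + 1 for every pair of nonadjacent vertices x and y, then G is hamiltonian-connected. -/
open Finset in
/-- If `f 0, …, f m` lists all vertices and `f i`, `f (i + 1)` have large degree sum, then some other
consecutive pair is joined to `f i`, `f (i + 1)` respectively. -/
lemma SimpleGraph.exists_adj_adj_succ_of_lt_degree_add_degree {V : Type*} [Fintype V]
    (G : SimpleGraph V) [DecidableRel G.Adj] {m i : ℕ} {f : ℕ → V}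
    (hf : ∀ w, ∃ k ≤ m, f k = w) (hi : i < m)
    (hdeg : m + 2 ≤ G.degree (f i) + G.degree (f (i + 1))) :
    ∃ j < m, j ≠ i ∧ G.Adj (f i) (f j) ∧ G.Adj (f (i + 1)) (f (j + 1)) := by
  classical
  let S := {j ∈ range m | G.Adj (f i) (f j)}
  let T := {j ∈ range m | G.Adj (f (i + 1)) (f (j + 1))}
  have hS : G.degree (f i) ≤ #S + 1 := by
    rw [← G.card_neighborFinset_eq_degree]
    refine (card_le_card (t := insert (f m) (S.image f)) fun w hw ↦ ?_).trans
      ((card_insert_le _ _).trans (Nat.succ_le_succ card_image_le))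
    obtain ⟨k, hk, rfl⟩ := hf w
    rw [SimpleGraph.mem_neighborFinset] at hw
    obtain rfl | hk := hk.eq_or_lt
    · exact mem_insert_self _ _
    · exact mem_insert_of_mem (mem_image_of_mem f (by simp [S, hk, hw]))
  have hT : G.degree (f (i + 1)) ≤ #T + 1 := by
    rw [← G.card_neighborFinset_eq_degree]
    refine (card_le_card (t := insert (f 0) (T.image fun j ↦ f (j + 1))) fun w hw ↦ ?_).trans
      ((card_insert_le _ _).trans (Nat.succ_le_succ card_image_le))
    obtain ⟨k, hk, rfl⟩ := hf w
    rw [SimpleGraph.mem_neighborFinset] at hw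
    cases k with
    | zero => exact mem_insert_self _ _
    | succ k =>
      exact mem_insert_of_mem (mem_image_of_mem (fun j ↦ f (j + 1)) (by simp [T, hw]; omega))
  have hU : #(S ∪ T) ≤ m - 1 := by
    have hsub : S ∪ T ⊆ (range m).erase i := by
      intro j hj
      simp only [S, T, mem_union, mem_filter, mem_range, mem_erase] at hj ⊢
      refine ⟨?_, by tauto⟩
      rintro rfl
      simp at hj
    simpa [hi] using card_le_card hsub
  have hne : (S ∩ T).Nonempty := by
    have := card_union_add_card_inter S T
    exact card_pos.mp (by omega)
  obtain ⟨j, hj⟩ := hne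
  simp only [S, T, mem_inter, mem_filter, mem_range] at hj
  refine ⟨j, hj.1.1, ?_, hj.1.2, hj.2.2⟩
  rintro rfl
  exact G.loopless.irrefl _ hj.1.2

open Finset in
/-- Reversing the segment `f (p + 1), …, f q` removes a non-adjacent consecutive pair. -/
lemma SimpleGraph.exists_card_not_adj_succ_lt {V : Type*} (G : SimpleGraph V) [DecidableRel G.Adj]
    {m p q : ℕ} {f : ℕ → V} (hf : ∀ w, ∃ k ≤ m, f k = w) (hpq : p < q) (hq : q < m)
    (hbad : ¬ G.Adj (f p) (f (p + 1)) ∨ ¬ G.Adj (f q) (f (q + 1)))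
    (hadj : G.Adj (f p) (f q)) (hadj' : G.Adj (f (p + 1)) (f (q + 1))) :
    ∃ g : ℕ → V, (∀ w, ∃ k ≤ m, g k = w) ∧ g 0 = f 0 ∧ g m = f m ∧
      #{k ∈ range m | ¬ G.Adj (g k) (g (k + 1))} < #{k ∈ range m | ¬ G.Adj (f k) (f (k + 1))} := by
  let r : ℕ → ℕ := fun k ↦ if p < k ∧ k ≤ q then p + 1 + q - k else k
  let s : ℕ → ℕ := fun k ↦ if p < k ∧ k < q then p + q - k else k
  let B := {k ∈ range m | ¬ G.Adj (f k) (f (k + 1))}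
  refine ⟨f ∘ r, fun w ↦ ?_, ?_, ?_, ?_⟩
  · obtain ⟨k, hk, rfl⟩ := hf w
    refine ⟨r k, by grind, ?_⟩
    have : r (r k) = k := by grind
    simp [this]
  · have : r 0 = 0 := by grind
    simp [this]
  · have : r m = m := by grind
    simp [this]
  · have hlt : #{k ∈ B | k ≠ p ∧ k ≠ q} < #B := by
      refine card_lt_card (filter_ssubset.mpr ?_)
      obtain h | h := hbad
      · exact ⟨p, by simp [B, h]; omega, by simp⟩
      · exact ⟨q, by simp [B, h]; omega, by simp⟩
    refine lt_of_le_of_lt ((card_le_card fun k hk ↦ ?_).trans (card_image_le (f := s))) hlt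
    simp only [mem_filter, mem_range, Function.comp_apply] at hk
    obtain ⟨hkm, hk⟩ := hk
    have hss : s (s k) = k := by grind
    refine mem_image.mpr ⟨s k, ?_, hss⟩
    have hkp : k ≠ p := by
      rintro rfl
      have h1 : r k = k := by grind
      have h2 : r (k + 1) = q := by grind
      exact hk (by rwa [h1, h2])
    have hkq : k ≠ q := by
      rintro rfl
      have h1 : r k = p + 1 := by grind
      have h2 : r (k + 1) = k + 1 := by grind
      exact hk (by rwa [h1, h2])
    simp only [B, mem_filter, mem_range]
    refine ⟨⟨by grind, ?_⟩, by grind, by grind⟩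
    by_cases hin : p < k ∧ k < q
    · have h1 : r k = s k + 1 := by grind
      have h2 : r (k + 1) = s k := by grind
      rw [h1, h2] at hk
      exact fun h ↦ hk h.symm
    · have h1 : r k = s k := by grind
      have h2 : r (k + 1) = s k + 1 := by grind
      rwa [h1, h2] at hk

lemma SimpleGraph.exists_walk_support_eq_map_range {V : Type*} (G : SimpleGraph V) (f : ℕ → V)
    (m : ℕ) (hf : ∀ k < m, G.Adj (f k) (f (k + 1))) :
    ∃ p : G.Walk (f 0) (f m), p.support = (List.range (m + 1)).map f := by
  induction m with
  | zero => exact ⟨.nil, by simp⟩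
  | succ m ih =>
    obtain ⟨p, hp⟩ := ih fun k hk ↦ hf k (by omega)
    refine ⟨p.concat (hf m (by omega)), ?_⟩
    rw [SimpleGraph.Walk.support_concat, hp, List.range_succ (n := m + 1)]
    simp

lemma exists_equiv_fin_apply_eq_apply_eq {V : Type*} [Fintype V] {m : ℕ}
    (hm : Fintype.card V = m + 1) {u v : V} (huv : u ≠ v) :
    ∃ e : V ≃ Fin (m + 1), e u = 0 ∧ e v = Fin.last m := by
  let e := Fintype.equivFinOfCardEq hm
  let e' := e.trans (Equiv.swap (e u) 0)
  have hu : e' u = 0 := by simp [e']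
  have hv : e' v ≠ 0 := fun h ↦ huv (e'.injective (hu.trans h.symm))
  have hl : Fin.last m ≠ 0 := by
    have := Fintype.one_lt_card_iff.mpr ⟨u, v, huv⟩
    simp [Fin.ext_iff]
    omega
  refine ⟨e'.trans (Equiv.swap (e' v) (Fin.last m)), ?_, by simp⟩
  rw [Equiv.trans_apply, hu, Equiv.swap_apply_of_ne_of_ne hv.symm hl.symm]

open Finset in
/-- Under Ore's condition, every ordering of the vertices can be rearranged, keeping its endpoints,
so that consecutive vertices are adjacent. -/
lemma SimpleGraph.exists_adj_succ_of_ore {V : Type*} [Fintype V] (G : SimpleGraph V)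
    [DecidableRel G.Adj] {m : ℕ}
    (h : ∀ x y, x ≠ y → ¬ G.Adj x y → m + 2 ≤ G.degree x + G.degree y)
    (hm : Fintype.card V = m + 1) (f : ℕ → V) (hf : ∀ w, ∃ k ≤ m, f k = w) :
    ∃ g : ℕ → V, (∀ w, ∃ k ≤ m, g k = w) ∧ g 0 = f 0 ∧ g m = f m ∧
      ∀ k < m, G.Adj (g k) (g (k + 1)) := by
  classical
  induction hc : #{k ∈ range m | ¬ G.Adj (f k) (f (k + 1))} using Nat.strong_induction_on
    generalizing f with
  | h c ih =>
    by_cases hall : ∀ k < m, G.Adj (f k) (f (k + 1))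
    · exact ⟨f, hf, rfl, rfl, hall⟩
    push Not at hall
    obtain ⟨i, hi, hbad⟩ := hall
    have hinj : Set.InjOn f (range (m + 1)) := by
      refine injOn_of_card_image_eq ?_
      have : (range (m + 1)).image f = univ := by
        ext w
        obtain ⟨k, hk, hkw⟩ := hf w
        simpa using ⟨k, by omega, hkw⟩
      rw [this, card_univ, hm, card_range]
    have hne : f i ≠ f (i + 1) := fun hfi ↦ by
      have := hinj (by simp; omega) (by simp; omega) hfi
      omega
    obtain ⟨j, hj, hji, h1, h2⟩ :=
      G.exists_adj_adj_succ_of_lt_degree_add_degree hf hi (h _ _ hne hbad)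
    obtain ⟨g, hg, hg0, hgm, hlt⟩ : ∃ g : ℕ → V, (∀ w, ∃ k ≤ m, g k = w) ∧ g 0 = f 0 ∧
        g m = f m ∧ #{k ∈ range m | ¬ G.Adj (g k) (g (k + 1))} <
          #{k ∈ range m | ¬ G.Adj (f k) (f (k + 1))} := by
      obtain hlt | hlt := hji.lt_or_gt
      · exact G.exists_card_not_adj_succ_lt hf hlt hi (.inr hbad) h1.symm h2.symm
      · exact G.exists_card_not_adj_succ_lt hf hlt hj (.inl hbad) h1 h2
    obtain ⟨g', hg', h0, hm', hadj⟩ := ih _ (hc ▸ hlt) g hg rfl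
    exact ⟨g', hg', h0.trans hg0, hm'.trans hgm, hadj⟩

theorem hamiltonianConnected_of_ore {V : Type*} [Fintype V] [DecidableEq V]
    (G : SimpleGraph V) [DecidableRel G.Adj] (hn : 3 ≤ Fintype.card V)
    (h : ∀ x y : V, x ≠ y → ¬ G.Adj x y →
      Fintype.card V + 1 ≤ G.degree x + G.degree y) :
    ∀ u v : V, u ≠ v → ∃ p : G.Walk u v, p.IsHamiltonian := by
  intro u v huv
  obtain ⟨m, hm⟩ : ∃ m, Fintype.card V = m + 1 := ⟨Fintype.card V - 1, by omega⟩
  obtain ⟨e, hu, hv⟩ := exists_equiv_fin_apply_eq_apply_eq hm huv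
  obtain ⟨g, hg, hg0, hgm, hadj⟩ := G.exists_adj_succ_of_ore (by rwa [hm] at h) hm
    (fun k ↦ e.symm (Fin.ofNat (m + 1) k)) fun w ↦ ⟨e w, by omega, by simp⟩
  have hgu : g 0 = u := by simp [hg0, Equiv.symm_apply_eq, hu]
  have hgv : g m = v := by
    rw [hgm, Equiv.symm_apply_eq, hv]
    simp
  subst hgu hgv
  obtain ⟨p, hp⟩ := G.exists_walk_support_eq_map_range g m hadj
  have hmem : ∀ w, w ∈ p.support := fun w ↦ by
    obtain ⟨k, hk, hkw⟩ := hg w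
    simpa [hp] using ⟨k, by omega, hkw⟩
  refine ⟨p, SimpleGraph.Walk.IsPath.isHamiltonian_of_mem (.mk' ?_) hmem⟩
  refine Multiset.coe_nodup.mp (Multiset.toFinset_card_eq_card_iff_nodup.mp ?_)
  have : (p.support : Multiset V).toFinset = Finset.univ := by ext w; simp [hmem]
  rw [this, Multiset.coe_card, Finset.card_univ, hm, hp]
  simp
end

section
/- Let G be a finite simple graph of order n ≥ 3. If the minimum degree of G satisfies δ(G) ≥ (n + 1)/2, then G is hamiltonian-connected. -/
namespace SimpleGraph

variable {V : Type*} (G : SimpleGraph V)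

/-- A sequence of consecutively adjacent vertices is the support of a walk. -/
lemma exists_walk_support_eq_map_range_s12 (f : ℕ → V) (m : ℕ)
    (h : ∀ k < m, G.Adj (f k) (f (k + 1))) :
    ∃ p : G.Walk (f 0) (f m), p.support = (List.range (m + 1)).map f := by
  induction m with
  | zero => exact ⟨Walk.nil, by simp⟩
  | succ m ih =>
    obtain ⟨p, hp⟩ := ih fun k hk => h k (hk.trans m.lt_succ_self)
    refine ⟨p.concat (h m m.lt_succ_self), ?_⟩
    rw [Walk.support_concat, hp, List.range_succ (n := m + 1)]
    simp

variable [DecidableRel G.Adj]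

/-- The indices `k < m` at which the sequence `f 0, …, f m` fails to follow an edge of `G`. -/
def gaps (m : ℕ) (f : ℕ → V) : Finset ℕ :=
  (Finset.range m).filter fun k => ¬ G.Adj (f k) (f (k + 1))

/-- The involution of `ℕ` reversing the segment `i + 1, …, j`. -/
def reverseSegment (i j k : ℕ) : ℕ := if i < k ∧ k ≤ j then i + 1 + j - k else k

lemma reverseSegment_reverseSegment (i j k : ℕ) :
    reverseSegment i j (reverseSegment i j k) = k := by
  unfold reverseSegment; split_ifs <;> omega

lemma reverseSegment_le {i j k m : ℕ} (hj : j < m) (hk : k ≤ m) :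
    reverseSegment i j k ≤ m := by
  unfold reverseSegment; split_ifs <;> omega

variable {G}

/-- Reversing the segment `i + 1, …, j` of a sequence removes a gap at `i` or `j` when both of
the new consecutive pairs are edges. -/
lemma card_gaps_reverseSegment_lt {m i j : ℕ} {f : ℕ → V} (hij : i < j) (hjm : j < m)
    (h₁ : G.Adj (f i) (f j)) (h₂ : G.Adj (f (i + 1)) (f (j + 1)))
    (hgap : i ∈ G.gaps m f ∨ j ∈ G.gaps m f) :
    (G.gaps m (f ∘ reverseSegment i j)).card < (G.gaps m f).card := by
  have hmaps : ∀ k ∈ G.gaps m (f ∘ reverseSegment i j),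
      (if i < k ∧ k < j then i + j - k else k) ∈ (G.gaps m f \ {i, j}) := by
    intro k hk
    simp only [gaps, Finset.mem_filter, Finset.mem_range, Function.comp_apply] at hk
    obtain ⟨hkm, hk⟩ := hk
    have hki : k ≠ i := by
      rintro rfl
      apply hk
      have e₁ : reverseSegment k j k = k := by simp [reverseSegment]
      have e₂ : reverseSegment k j (k + 1) = j := by
        unfold reverseSegment; split_ifs <;> omega
      rwa [e₁, e₂]
    have hkj : k ≠ j := by
      rintro rfl
      apply hk
      have e₁ : reverseSegment i k k = i + 1 := by
        unfold reverseSegment; split_ifs <;> omega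
      have e₂ : reverseSegment i k (k + 1) = k + 1 := by simp [reverseSegment]
      rwa [e₁, e₂]
    simp only [gaps, Finset.mem_sdiff, Finset.mem_filter, Finset.mem_range, Finset.mem_insert,
      Finset.mem_singleton]
    split_ifs with h
    · have e₁ : reverseSegment i j k = i + j - k + 1 := by
        unfold reverseSegment; split_ifs <;> omega
      have e₂ : reverseSegment i j (k + 1) = i + j - k := by
        unfold reverseSegment; split_ifs <;> omega
      rw [e₁, e₂] at hk
      exact ⟨⟨by omega, fun h' => hk h'.symm⟩, by omega⟩
    · have e₁ : reverseSegment i j k = k := by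
        unfold reverseSegment; split_ifs <;> omega
      have e₂ : reverseSegment i j (k + 1) = k + 1 := by
        unfold reverseSegment; split_ifs <;> omega
      rw [e₁, e₂] at hk
      exact ⟨⟨hkm, hk⟩, by omega⟩
  refine (Finset.card_le_card_of_injOn _ hmaps ?_).trans_lt (Finset.card_lt_card ?_)
  · intro k _ l _ h
    simp only at h
    split_ifs at h <;> omega
  · rw [Finset.ssubset_iff_of_subset Finset.sdiff_subset]
    rcases hgap with h | h
    · exact ⟨i, h, by simp⟩
    · exact ⟨j, h, by simp⟩

/-- Given a gap at `i` in an enumeration of the vertices, a minimum degree above half the order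
yields a second index `j` such that crossing over between `i` and `j` uses two edges. -/
lemma exists_adj_adj_of_not_adj [Fintype V] {m i : ℕ} {f : ℕ → V}
    (hsurj : ∀ w, ∃ k ≤ m, f k = w) (hi : i < m) (hδ : m + 2 ≤ 2 * G.minDegree) :
    ∃ j < m, j ≠ i ∧ G.Adj (f i) (f j) ∧ G.Adj (f (i + 1)) (f (j + 1)) := by
  classical
  by_contra! hcon
  set A := (Finset.range m).filter fun j => G.Adj (f i) (f j)
  set B := (Finset.range m).filter fun j => G.Adj (f (i + 1)) (f (j + 1))
  have hA : G.degree (f i) ≤ A.card + 1 := by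
    have hsub : G.neighborFinset (f i) ⊆ insert (f m) (A.image f) := by
      intro w hw
      rw [mem_neighborFinset] at hw
      obtain ⟨k, hk, rfl⟩ := hsurj w
      rcases hk.eq_or_lt with rfl | hk
      · simp
      · exact Finset.mem_insert_of_mem (Finset.mem_image_of_mem _ (by simp [A, hk, hw]))
    exact (Finset.card_le_card hsub).trans <| (Finset.card_insert_le _ _).trans <|
      Nat.add_le_add_right Finset.card_image_le _
  have hB : G.degree (f (i + 1)) ≤ B.card + 1 := by
    have hsub : G.neighborFinset (f (i + 1)) ⊆ insert (f 0) (B.image fun j => f (j + 1)) := by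
      intro w hw
      rw [mem_neighborFinset] at hw
      obtain ⟨k, hk, rfl⟩ := hsurj w
      rcases k with _ | k
      · simp
      · exact Finset.mem_insert_of_mem
          (Finset.mem_image.2 ⟨k, by simp [B, Nat.lt_of_succ_le hk, hw], rfl⟩)
    exact (Finset.card_le_card hsub).trans <| (Finset.card_insert_le _ _).trans <|
      Nat.add_le_add_right Finset.card_image_le _
  have hdisj : Disjoint A B := by
    rw [Finset.disjoint_left]
    intro j hjA hjB
    simp only [A, B, Finset.mem_filter, Finset.mem_range] at hjA hjB
    exact hcon j hjA.1 (fun h => G.irrefl (h ▸ hjA.2)) hjA.2 hjB.2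
  have hsub : A ∪ B ⊆ (Finset.range m).erase i := by
    intro j hj
    simp only [A, B, Finset.mem_union, Finset.mem_filter, Finset.mem_range] at hj
    rw [Finset.mem_erase, Finset.mem_range]
    refine ⟨?_, by tauto⟩
    rintro rfl
    simp at hj
  have hcard := Finset.card_le_card hsub
  rw [Finset.card_union_of_disjoint hdisj,
    Finset.card_erase_of_mem (Finset.mem_range.2 hi), Finset.card_range] at hcard
  have h₁ := G.minDegree_le_degree (f i)
  have h₂ := G.minDegree_le_degree (f (i + 1))
  omega

/-- If the minimum degree exceeds half the order, the endpoints of any enumeration of the vertices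
are joined by a Hamiltonian path. -/
lemma exists_isHamiltonian_of_enumeration [Fintype V] [DecidableEq V] {m : ℕ}
    (hδ : m + 2 ≤ 2 * G.minDegree) (f : ℕ → V) (hinj : Set.InjOn f (Set.Iic m))
    (hsurj : ∀ w, ∃ k ≤ m, f k = w) {u v : V} (hu : f 0 = u) (hv : f m = v) :
    ∃ p : G.Walk u v, p.IsHamiltonian := by
  induction hb : (G.gaps m f).card using Nat.strong_induction_on generalizing f with
  | _ b ih =>
  subst hb
  have hrev : ∀ i j, i < j → j < m → G.Adj (f i) (f j) → G.Adj (f (i + 1)) (f (j + 1)) →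
      (i ∈ G.gaps m f ∨ j ∈ G.gaps m f) → ∃ p : G.Walk u v, p.IsHamiltonian := by
    intro i j hij hjm h₁ h₂ hgap
    have e₀ : reverseSegment i j 0 = 0 := by simp [reverseSegment]
    have em : reverseSegment i j m = m := by
      unfold reverseSegment; split_ifs <;> omega
    refine ih _ (card_gaps_reverseSegment_lt hij hjm h₁ h₂ hgap)
      (f ∘ reverseSegment i j) ?_ ?_ (by simp [e₀, hu]) (by simp [em, hv]) rfl
    · intro k hk l hl h
      have := hinj (reverseSegment_le hjm hk) (reverseSegment_le hjm hl) h
      rw [← reverseSegment_reverseSegment i j k, this, reverseSegment_reverseSegment]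
    · intro w
      obtain ⟨k, hk, rfl⟩ := hsurj w
      exact ⟨reverseSegment i j k, reverseSegment_le hjm hk, by simp [reverseSegment_reverseSegment]⟩
  rcases (G.gaps m f).eq_empty_or_nonempty with hempty | ⟨i, hi⟩
  · subst hu hv
    obtain ⟨p, hp⟩ := G.exists_walk_support_eq_map_range_s12 f m fun k hk => by
      by_contra hadj
      have : k ∈ G.gaps m f := by simp [gaps, hk, hadj]
      simp [hempty] at this
    refine ⟨p, (Walk.IsPath.mk' ?_).isHamiltonian_of_mem fun w => ?_⟩
    · rw [hp]
      refine List.Nodup.map_on (fun k hk l hl h => hinj ?_ ?_ h) List.nodup_range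
      · exact Nat.lt_succ_iff.1 (List.mem_range.1 hk)
      · exact Nat.lt_succ_iff.1 (List.mem_range.1 hl)
    · obtain ⟨k, hk, rfl⟩ := hsurj w
      rw [hp]
      exact List.mem_map_of_mem (List.mem_range.2 (Nat.lt_succ_of_le hk))
  · have him : i < m := Finset.mem_range.1 (Finset.mem_filter.1 hi).1
    obtain ⟨j, hjm, hji, h₁, h₂⟩ := exists_adj_adj_of_not_adj hsurj him hδ
    rcases hji.lt_or_gt with h | h
    · exact hrev j i h him h₁.symm h₂.symm (.inr hi)
    · exact hrev i j h hjm h₁ h₂ (.inl hi)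

end SimpleGraph

/-- A finite type with `m + 1` elements can be enumerated with prescribed distinct endpoints. -/
lemma exists_equiv_fin_of_ne {V : Type*} [Fintype V] [DecidableEq V] {m : ℕ}
    (hm : Fintype.card V = m + 1) {u v : V} (huv : u ≠ v) :
    ∃ e : Fin (m + 1) ≃ V, e 0 = u ∧ e (Fin.last m) = v := by
  have hm0 : (0 : Fin (m + 1)) ≠ Fin.last m := by
    intro h
    have hm' : m = 0 := by simpa using (congrArg Fin.val h).symm
    have := Fintype.card_le_one_iff.1 (by omega : Fintype.card V ≤ 1) u v
    exact huv this
  let e := Fintype.equivFinOfCardEq hm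
  let e₁ := e.symm.trans (Equiv.swap (e.symm 0) u)
  have h₁ : e₁ 0 = u := by simp [e₁]
  refine ⟨e₁.trans (Equiv.swap (e₁ (Fin.last m)) v), ?_, by simp⟩
  rw [Equiv.trans_apply, Equiv.swap_apply_of_ne_of_ne (e₁.injective.ne hm0) (h₁ ▸ huv), h₁]

theorem hamiltonianConnected_of_minDegree {V : Type*} [Fintype V] [DecidableEq V]
    (G : SimpleGraph V) [DecidableRel G.Adj] (hn : 3 ≤ Fintype.card V)
    (hδ : Fintype.card V + 1 ≤ 2 * G.minDegree) :
    ∀ u v : V, u ≠ v → ∃ p : G.Walk u v, p.IsHamiltonian := by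
  intro u v huv
  obtain ⟨m, hm⟩ : ∃ m, Fintype.card V = m + 1 := ⟨Fintype.card V - 1, by omega⟩
  obtain ⟨e, rfl, rfl⟩ := exists_equiv_fin_of_ne hm huv
  refine SimpleGraph.exists_isHamiltonian_of_enumeration (m := m) (by omega)
    (fun k => e (Fin.ofNat (m + 1) k)) ?_ ?_ rfl (congrArg e (by ext; simp))
  · intro k hk l hl h
    have := congrArg Fin.val (e.injective h)
    simpa [Fin.ofNat, Nat.mod_eq_of_lt (Nat.lt_succ_of_le hk),
      Nat.mod_eq_of_lt (Nat.lt_succ_of_le hl)] using this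
  · intro w
    refine ⟨(e.symm w).val, Nat.lt_succ_iff.1 (e.symm w).isLt, ?_⟩
    simp
end
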